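/- Let U, A, Y be random variables taking values in finite sets, let p ∈ [0,1], and let V be a Bernoulli(p) random variable independent of the triple (U,A,Y). Let e be a symbol not in the alphabet of Y and define Yd = Y if V = 1 and Yd = e if V = 0. Then I(A ; Yd | U) = p · I(A ; Y | U). In particular (taking U constant), I(A ; Yd) = p · I(A ; Y). -/

import Mathlib

open MeasureTheory

namespace SF

variable {Ω : Type*} [MeasurableSpace Ω]

/-- The probability that a random variable `X` takes the value `a`. -/
noncomputable def pr (μ : Measure Ω) {A : Type*} (X : Ω → A) (a : A) : ℝ :=
  (μ (X ⁻¹' {a})).toReal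

/-- Shannon entropy (natural logarithm) of a finite-valued random variable. -/
noncomputable def ent (μ : Measure Ω) {A : Type*} [Fintype A] (X : Ω → A) : ℝ :=
  ∑ a, Real.negMulLog (pr μ X a)

/-- Conditional entropy `H(X | Y)`. -/
noncomputable def condEnt (μ : Measure Ω) {A B : Type*} [Fintype A] [Fintype B]
    (X : Ω → A) (Y : Ω → B) : ℝ :=
  ent μ (fun ω => (X ω, Y ω)) - ent μ Y

/-- Mutual information `I(X ; Y)`. -/
noncomputable def mi (μ : Measure Ω) {A B : Type*} [Fintype A] [Fintype B]
    (X : Ω → A) (Y : Ω → B) : ℝ :=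
  ent μ X + ent μ Y - ent μ (fun ω => (X ω, Y ω))

/-- Conditional mutual information `I(X ; Y | Z)`. -/
noncomputable def cmi (μ : Measure Ω) {A B C : Type*} [Fintype A] [Fintype B] [Fintype C]
    (X : Ω → A) (Y : Ω → B) (Z : Ω → C) : ℝ :=
  ent μ (fun ω => (X ω, Z ω)) + ent μ (fun ω => (Y ω, Z ω))
    - ent μ (fun ω => (X ω, Y ω, Z ω)) - ent μ Z

end SF

open SF MeasureTheory

namespace SF

section Pushforward

theorem preimage_comp_eq_biUnion {Ω B C : Type*} [Fintype B] [DecidableEq C] {X : Ω → B}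
    (f : B → C) (c : C) :
    (fun ω => f (X ω)) ⁻¹' {c} = ⋃ b ∈ Finset.univ.filter (f · = c), X ⁻¹' {b} := by
  ext; simp

variable {Ω B C : Type*} [MeasurableSpace Ω] {μ : Measure Ω} {X : Ω → B}

theorem pr_comp_equiv (e : B ≃ C) (X : Ω → B) (b : B) :
    pr μ (fun ω => e (X ω)) (e b) = pr μ X b := by
  have h : (fun ω => e (X ω)) ⁻¹' {e b} = X ⁻¹' {b} := by ext; simp
  rw [pr, pr, h]

theorem ent_comp_equiv [Fintype B] [Fintype C] (e : B ≃ C) (X : Ω → B) :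
    ent μ (fun ω => e (X ω)) = ent μ X := by
  simp only [ent, ← e.sum_comp, pr_comp_equiv]

variable [Fintype B]

theorem measurableSet_fiber_comp (hX : ∀ b, MeasurableSet (X ⁻¹' {b})) (f : B → C) (c : C) :
    MeasurableSet ((fun ω => f (X ω)) ⁻¹' {c}) := by
  classical
  rw [preimage_comp_eq_biUnion]
  exact Finset.measurableSet_biUnion _ fun b _ => hX b

theorem pr_comp [IsFiniteMeasure μ] [DecidableEq C] (hX : ∀ b, MeasurableSet (X ⁻¹' {b}))
    (f : B → C) (c : C) :
    pr μ (fun ω => f (X ω)) c = ∑ b, if f b = c then pr μ X b else 0 := by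
  rw [← Finset.sum_filter, pr, preimage_comp_eq_biUnion]
  refine measureReal_biUnion_finset (fun a _ b _ hab => ?_) fun b _ => hX b
  exact Disjoint.preimage X (Set.disjoint_singleton.2 hab)

theorem sum_pr [IsProbabilityMeasure μ] (hX : ∀ b, MeasurableSet (X ⁻¹' {b})) :
    ∑ b, pr μ X b = 1 := by
  have h := pr_comp (μ := μ) hX (fun _ => ()) ()
  simpa [pr] using h.symm

end Pushforward

section Erasure

variable {Ω D E C : Type*} [MeasurableSpace Ω] {μ : Measure Ω} [IsProbabilityMeasure μ]
  [Fintype D] [Fintype E] [Fintype C] {V : Ω → Bool} {W : Ω → D}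

/-- The joint entropy of an erased variable `f(W)` and a side variable `g(W)`, when the erasure
flag `V` is independent of `W`. -/
theorem ent_erasure (hmeas : ∀ x, MeasurableSet ((fun ω => (V ω, W ω)) ⁻¹' {x}))
    (hindep : ∀ v d, pr μ (fun ω => (V ω, W ω)) (v, d) = pr μ V v * pr μ W d)
    (f : D → E) (g : D → C) :
    ent μ (fun ω => (if V ω then some (f (W ω)) else none, g (W ω)))
      = Real.negMulLog (pr μ V true) + Real.negMulLog (pr μ V false)
        + pr μ V true * ent μ (fun ω => (f (W ω), g (W ω)))
        + pr μ V false * ent μ (fun ω => g (W ω)) := by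
  classical
  have hW : ∀ d, MeasurableSet (W ⁻¹' {d}) := measurableSet_fiber_comp hmeas Prod.snd
  have hsome (y : E) (z : C) :
      pr μ (fun ω => (if V ω then some (f (W ω)) else none, g (W ω))) (some y, z)
        = pr μ V true * pr μ (fun ω => (f (W ω), g (W ω))) (y, z) := by
    rw [pr_comp hW (fun d => (f d, g d)),
      pr_comp hmeas (fun x => (if x.1 then some (f x.2) else none, g x.2))]
    simp [Fintype.sum_prod_type, hindep, Finset.mul_sum]
  have hnone (z : C) :
      pr μ (fun ω => (if V ω then some (f (W ω)) else none, g (W ω))) (none, z)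
        = pr μ V false * pr μ (fun ω => g (W ω)) z := by
    rw [pr_comp hW g, pr_comp hmeas (fun x => (if x.1 then some (f x.2) else none, g x.2))]
    simp [Fintype.sum_prod_type, hindep, Finset.mul_sum]
  have hfg := sum_pr (μ := μ) (measurableSet_fiber_comp hW fun d => (f d, g d))
  have hg := sum_pr (μ := μ) (measurableSet_fiber_comp hW g)
  rw [Fintype.sum_prod_type] at hfg
  simp only [ent, Fintype.sum_prod_type, Fintype.sum_option, hsome, hnone, Real.negMulLog_mul,
    Finset.sum_add_distrib, ← Finset.mul_sum, ← Finset.sum_mul, hfg, hg]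
  ring

end Erasure

end SF

/-- Let `U, A, Y` be finite-valued random variables, `p ∈ [0,1]`, and let
`V ~ Bernoulli(p)` be independent of `(U, A, Y)`. With `e` a fresh symbol (modelled as
`none` in `Option`), define `Yd = Y` if `V = 1` and `Yd = e` if `V = 0`. Then
`I(A ; Yd | U) = p · I(A ; Y | U)`, and in particular `I(A ; Yd) = p · I(A ; Y)`. -/
theorem statement8 {Ω : Type*} [MeasurableSpace Ω] (μ : Measure Ω) [IsProbabilityMeasure μ]
    {AU AA AY : Type*} [Fintype AU] [Fintype AA] [Fintype AY]
    (U : Ω → AU) (A : Ω → AA) (Y : Ω → AY) (V : Ω → Bool)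
    (p : ℝ) (hp0 : 0 ≤ p) (hp1 : p ≤ 1)
    (hp : pr μ V true = p)
    (hmeas : ∀ (u : AU) (a : AA) (y : AY) (v : Bool),
      MeasurableSet ((fun ω => (U ω, A ω, Y ω, V ω)) ⁻¹' {(u, a, y, v)}))
    (hindep : ∀ (v : Bool) (u : AU) (a : AA) (y : AY),
      pr μ (fun ω => (V ω, U ω, A ω, Y ω)) (v, u, a, y)
        = pr μ V v * pr μ (fun ω => (U ω, A ω, Y ω)) (u, a, y)) :
    cmi μ A (fun ω => if V ω then some (Y ω) else none) U = p * cmi μ A Y U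
    ∧ mi μ A (fun ω => if V ω then some (Y ω) else none) = p * mi μ A Y := by
  have hM : ∀ x, MeasurableSet ((fun ω => (V ω, U ω, A ω, Y ω)) ⁻¹' {x}) :=
    measurableSet_fiber_comp (X := fun ω => (U ω, A ω, Y ω, V ω))
      (fun x => hmeas x.1 x.2.1 x.2.2.1 x.2.2.2) fun x => (x.2.2.2, x.1, x.2.1, x.2.2.1)
  have hI : ∀ v d, pr μ (fun ω => (V ω, U ω, A ω, Y ω)) (v, d)
      = pr μ V v * pr μ (fun ω => (U ω, A ω, Y ω)) d := fun v d => hindep v d.1 d.2.1 d.2.2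
  have hV := sum_pr (μ := μ) (measurableSet_fiber_comp hM Prod.fst)
  have hq : pr μ V false = 1 - p := by
    simp only [Fintype.sum_bool] at hV
    linarith
  have hU := ent_erasure hM hI (fun d => d.2.2) fun d => d.1
  have hA := ent_erasure hM hI (fun d => d.2.2) fun d => d.2.1
  have hAU := ent_erasure hM hI (fun d => d.2.2) fun d => (d.2.1, d.1)
  have hc := ent_erasure hM hI (fun d => d.2.2) fun _ => ()
  simp only [hp, hq] at hU hA hAU hc
  have hswap {E : Type _} [Fintype E] (Z : Ω → E) :
      ent μ (fun ω => (A ω, Z ω)) = ent μ (fun ω => (Z ω, A ω)) :=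
    ent_comp_equiv (Equiv.prodComm E AA) fun ω => (Z ω, A ω)
  have hrot {E : Type _} [Fintype E] (Z : Ω → E) :
      ent μ (fun ω => (A ω, Z ω, U ω)) = ent μ (fun ω => (Z ω, A ω, U ω)) :=
    ent_comp_equiv ((Equiv.prodAssoc E AA AU).symm.trans
      (((Equiv.prodComm E AA).prodCongr (Equiv.refl AU)).trans (Equiv.prodAssoc AA E AU)))
      fun ω => (Z ω, A ω, U ω)
  have hunit {E : Type _} [Fintype E] (Z : Ω → E) : ent μ (fun ω => (Z ω, ())) = ent μ Z :=
    ent_comp_equiv (Equiv.prodPUnit E).symm Z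
  have hzero : ent μ (fun _ => ()) = 0 := by simp [ent, pr]
  rw [hunit, hunit, hzero] at hc
  constructor
  · rw [cmi, cmi, hrot, hrot, hU, hAU]
    ring
  · rw [mi, mi, hswap, hswap, hA, hc]
    ring
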